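/- Fix q ∈ (0,1). Let F be the CDF of any probability distribution on [0,∞) with finite mean, and let â be the SAA decision based on n IID samples from F. For any δ ∈ (0,1), if n > log(2/δ)/(2·(min{q,1−q})²), then with probability at least 1−δ, the multiplicative regret satisfies (L(â) − L(a*))/L(a*) ≤ 2 / (min{q,1−q}·√(2n/log(2/δ)) − 1). -/

import Mathlib

open MeasureTheory Set

noncomputable section

/-- The Newsvendor loss `ℓ(a,Z) = q·max{Z−a,0} + (1−q)·max{a−Z,0}` with critical quantile `q`. -/
def nvLoss (q a z : ℝ) : ℝ := q * max (z - a) 0 + (1 - q) * max (a - z) 0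

/-- The expected Newsvendor loss `L(a)` under the demand distribution `μ`. -/
def expLoss (q : ℝ) (μ : Measure ℝ) (a : ℝ) : ℝ := ∫ z, nvLoss q a z ∂μ

/-- The CDF of the demand distribution `μ`. -/
def cdf' (μ : Measure ℝ) (z : ℝ) : ℝ := (μ (Iic z)).toReal

/-- The optimal decision `a* = inf {a ≥ 0 : F(a) ≥ q}`. -/
def optDec (q : ℝ) (μ : Measure ℝ) : ℝ := sInf {a : ℝ | 0 ≤ a ∧ q ≤ cdf' μ a}

/-- The empirical CDF of the samples `ω : Fin n → ℝ`. -/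
def empCdf (n : ℕ) (ω : Fin n → ℝ) (z : ℝ) : ℝ :=
  (∑ i : Fin n, if ω i ≤ z then (1 : ℝ) else 0) / n

/-- The SAA (sample average approximation) decision `â = inf {a ≥ 0 : F̂(a) ≥ q}`. -/
def saa (q : ℝ) (n : ℕ) (ω : Fin n → ℝ) : ℝ := sInf {a : ℝ | 0 ≤ a ∧ q ≤ empCdf n ω a}

/-- The joint law of `n` iid samples from `μ`. -/
def iid (μ : Measure ℝ) (n : ℕ) : Measure (Fin n → ℝ) := Measure.pi fun _ => μ

/-- A distribution `μ` is `(β,γ,ζ)`-clustered if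
`|a − a*| ≤ (1/γ)·|F(a) − q|^{1/(β+1)}` for all `a ∈ [a*−ζ, a*+ζ]`. -/
def Clustered (q β γ ζ : ℝ) (μ : Measure ℝ) : Prop :=
  ∀ a ∈ Icc (optDec q μ - ζ) (optDec q μ + ζ),
    |a - optDec q μ| ≤ (1 / γ) * |cdf' μ a - q| ^ ((1 : ℝ) / (β + 1))

open ProbabilityTheory Filter Topology

lemma nvLoss_nonneg {q : ℝ} (hq : q ∈ Ioo (0 : ℝ) 1) (a z : ℝ) : 0 ≤ nvLoss q a z := by
  have h₀ := hq.1.le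
  have h₁ : 0 ≤ 1 - q := by linarith [hq.2]
  unfold nvLoss
  positivity

lemma integrable_nvLoss {μ : Measure ℝ} [IsFiniteMeasure μ]
    (hmean : Integrable (fun z => z) μ) (q a : ℝ) : Integrable (nvLoss q a) μ :=
  ((hmean.sub (integrable_const a)).pos_part.const_mul q).add
    (((integrable_const a).sub hmean).pos_part.const_mul (1 - q))

lemma nvLoss_sub_le_of_le {q a b : ℝ} (hq : q ∈ Ioo (0 : ℝ) 1) (hab : a ≤ b) (z : ℝ) :
    nvLoss q a z - nvLoss q b z ≤ (b - a) * (q - (Iic a).indicator 1 z) := by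
  obtain ⟨h₀, h₁⟩ := hq
  by_cases hz : z ≤ a
  · rw [indicator_of_mem (mem_Iic.2 hz), Pi.one_apply, nvLoss, nvLoss, max_eq_right (by linarith),
      max_eq_left (by linarith), max_eq_right (by linarith), max_eq_left (by linarith)]
    linarith
  · rw [indicator_of_notMem (by simpa using hz), nvLoss, nvLoss,
      max_eq_left (a := z - a) (by linarith), max_eq_right (a := a - z) (by linarith)]
    nlinarith [le_max_left (z - b) 0, le_max_right (b - z) 0]

lemma nvLoss_sub_le_of_ge {q a b : ℝ} (hq : q ∈ Ioo (0 : ℝ) 1) (hab : a ≤ b) (z : ℝ) :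
    nvLoss q b z - nvLoss q a z ≤ (b - a) * ((Iio b).indicator 1 z - q) := by
  obtain ⟨h₀, h₁⟩ := hq
  by_cases hz : z < b
  · rw [indicator_of_mem (mem_Iio.2 hz), Pi.one_apply, nvLoss, nvLoss,
      max_eq_right (a := z - b) (by linarith), max_eq_left (a := b - z) (by linarith)]
    nlinarith [le_max_left (a - z) 0, le_max_right (z - a) 0]
  · rw [indicator_of_notMem (by simpa using hz), nvLoss, nvLoss, max_eq_left (by linarith),
      max_eq_right (by linarith), max_eq_left (by linarith), max_eq_right (by linarith)]
    linarith

lemma le_nvLoss_right {q a b : ℝ} (hq : q ∈ Ioo (0 : ℝ) 1) (hab : a ≤ b) (z : ℝ) :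
    (1 - q) * (b - a) * (Iic a).indicator 1 z ≤ nvLoss q b z := by
  by_cases hz : z ≤ a
  · rw [indicator_of_mem (mem_Iic.2 hz), Pi.one_apply, nvLoss, max_eq_right (by linarith),
      max_eq_left (by linarith)]
    nlinarith [hq.2]
  · rw [indicator_of_notMem (by simpa using hz), mul_zero]
    exact nvLoss_nonneg hq b z

lemma le_nvLoss_left {q a b : ℝ} (hq : q ∈ Ioo (0 : ℝ) 1) (hab : a ≤ b) (z : ℝ) :
    q * (b - a) * (1 - (Iio b).indicator 1 z) ≤ nvLoss q a z := by
  by_cases hz : z < b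
  · rw [indicator_of_mem (mem_Iio.2 hz), Pi.one_apply, sub_self, mul_zero]
    exact nvLoss_nonneg hq a z
  · rw [indicator_of_notMem (by simpa using hz), nvLoss, max_eq_left (by linarith),
      max_eq_right (by linarith)]
    nlinarith [hq.1]

section ExpLoss

variable {q a b : ℝ} {μ : Measure ℝ} [IsProbabilityMeasure μ]

lemma integrable_indicator_one_real {s : Set ℝ} (hs : MeasurableSet s) :
    Integrable (s.indicator (1 : ℝ → ℝ)) μ :=
  (integrable_const (1 : ℝ)).indicator hs

lemma expLoss_sub_le_of_le (hq : q ∈ Ioo (0 : ℝ) 1) (hmean : Integrable (fun z => z) μ)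
    (hab : a ≤ b) : expLoss q μ a - expLoss q μ b ≤ (b - a) * (q - μ.real (Iic a)) := by
  have hi := integrable_indicator_one_real (μ := μ) (measurableSet_Iic (a := a))
  have h := integral_mono ((integrable_nvLoss hmean q a).sub (integrable_nvLoss hmean q b))
    (((integrable_const q).sub hi).const_mul (b - a)) (nvLoss_sub_le_of_le hq hab)
  rw [integral_sub' (integrable_nvLoss hmean q a) (integrable_nvLoss hmean q b),
    integral_const_mul] at h
  simp only [Pi.sub_apply] at h
  rwa [integral_sub (integrable_const q) hi, integral_const,
    integral_indicator_one measurableSet_Iic, probReal_univ, one_smul] at h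

lemma expLoss_sub_le_of_ge (hq : q ∈ Ioo (0 : ℝ) 1) (hmean : Integrable (fun z => z) μ)
    (hab : a ≤ b) : expLoss q μ b - expLoss q μ a ≤ (b - a) * (μ.real (Iio b) - q) := by
  have hi := integrable_indicator_one_real (μ := μ) (measurableSet_Iio (a := b))
  have h := integral_mono ((integrable_nvLoss hmean q b).sub (integrable_nvLoss hmean q a))
    ((hi.sub (integrable_const q)).const_mul (b - a)) (nvLoss_sub_le_of_ge hq hab)
  rw [integral_sub' (integrable_nvLoss hmean q b) (integrable_nvLoss hmean q a),
    integral_const_mul] at h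
  simp only [Pi.sub_apply] at h
  rwa [integral_sub hi (integrable_const q), integral_const,
    integral_indicator_one measurableSet_Iio, probReal_univ, one_smul] at h

lemma le_expLoss_right (hq : q ∈ Ioo (0 : ℝ) 1) (hmean : Integrable (fun z => z) μ)
    (hab : a ≤ b) : (1 - q) * (b - a) * μ.real (Iic a) ≤ expLoss q μ b := by
  have h := integral_mono
    ((integrable_indicator_one_real (μ := μ) (measurableSet_Iic (a := a))).const_mul _)
    (integrable_nvLoss hmean q b) (le_nvLoss_right hq hab)
  rwa [integral_const_mul, integral_indicator_one measurableSet_Iic] at h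

lemma le_expLoss_left (hq : q ∈ Ioo (0 : ℝ) 1) (hmean : Integrable (fun z => z) μ)
    (hab : a ≤ b) : q * (b - a) * (1 - μ.real (Iio b)) ≤ expLoss q μ a := by
  have hi := integrable_indicator_one_real (μ := μ) (measurableSet_Iio (a := b))
  have h := integral_mono (((integrable_const 1).sub hi).const_mul _)
    (integrable_nvLoss hmean q a) (le_nvLoss_left hq hab)
  rw [integral_const_mul] at h
  simp only [Pi.sub_apply] at h
  rwa [integral_sub (integrable_const 1) hi, integral_const,
    integral_indicator_one measurableSet_Iio, probReal_univ, one_smul] at h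

/-- If `a` is an `ε`-approximate `q`-quantile, its multiplicative regret relative to any other
decision is at most `2ε / (min q (1 - q) - ε)`. -/
lemma div_expLoss_le_of_approx_quantile (hq : q ∈ Ioo (0 : ℝ) 1)
    (hmean : Integrable (fun z => z) μ) {ε : ℝ} (hε : 0 < ε) (hεq : ε < min q (1 - q))
    (hlo : q - ε ≤ μ.real (Iic a)) (hhi : μ.real (Iio a) ≤ q + ε) (b : ℝ) :
    (expLoss q μ a - expLoss q μ b) / expLoss q μ b ≤ 2 * ε / (min q (1 - q) - ε) := by
  obtain ⟨h₁, h₂⟩ := lt_min_iff.1 hεq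
  have hm : 0 < min q (1 - q) - ε := sub_pos.2 hεq
  have hL : 0 ≤ expLoss q μ b := integral_nonneg (nvLoss_nonneg hq b)
  obtain hL | hL := hL.eq_or_lt
  · rw [← hL, div_zero]
    positivity
  suffices h : expLoss q μ a - expLoss q μ b ≤ ε * |b - a| ∧
      (min q (1 - q) - ε) / 2 * |b - a| ≤ expLoss q μ b by
    rw [div_le_div_iff₀ hL hm]
    nlinarith [h.1, h.2]
  obtain ⟨hq₀, hq₁⟩ := hq
  obtain hab | hab := le_total a b
  · rw [abs_of_nonneg (sub_nonneg.2 hab)]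
    refine ⟨(expLoss_sub_le_of_le ⟨hq₀, hq₁⟩ hmean hab).trans ?_,
      le_trans ?_ (le_expLoss_right ⟨hq₀, hq₁⟩ hmean hab)⟩
    · nlinarith
    · have key : (min q (1 - q) - ε) / 2 ≤ (1 - q) * (q - ε) := by
        obtain h | h := le_total q (1 - q)
        · rw [min_eq_left h]
          nlinarith
        · rw [min_eq_right h]
          nlinarith
      calc (min q (1 - q) - ε) / 2 * (b - a) ≤ (1 - q) * (q - ε) * (b - a) := by
            gcongr
        _ = (1 - q) * (b - a) * (q - ε) := by ring
        _ ≤ (1 - q) * (b - a) * μ.real (Iic a) := by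
            gcongr
  · rw [abs_of_nonpos (sub_nonpos.2 hab), neg_sub]
    refine ⟨(expLoss_sub_le_of_ge ⟨hq₀, hq₁⟩ hmean hab).trans ?_,
      le_trans ?_ (le_expLoss_left ⟨hq₀, hq₁⟩ hmean hab)⟩
    · nlinarith
    · have key : (min q (1 - q) - ε) / 2 ≤ q * (1 - q - ε) := by
        obtain h | h := le_total q (1 - q)
        · rw [min_eq_left h]
          nlinarith
        · rw [min_eq_right h]
          nlinarith
      calc (min q (1 - q) - ε) / 2 * (a - b) ≤ q * (1 - q - ε) * (a - b) := by
            gcongr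
        _ = q * (a - b) * (1 - q - ε) := by ring
        _ ≤ q * (a - b) * (1 - μ.real (Iio a)) := by
            refine mul_le_mul_of_nonneg_left (by linarith) ?_
            exact mul_nonneg hq₀.le (by linarith)

end ExpLoss

lemma optDec_nonneg {p : ℝ} {μ : Measure ℝ} : 0 ≤ optDec p μ :=
  Real.sInf_nonneg fun _ ha => ha.1

section Quantile

variable {μ : Measure ℝ} [IsProbabilityMeasure μ] {p : ℝ}

lemma cdf'_eq_cdf (z : ℝ) : cdf' μ z = cdf μ z := (cdf_eq_real μ z).symm

lemma bddBelow_setOf_nonneg_and (P : ℝ → Prop) : BddBelow {a : ℝ | 0 ≤ a ∧ P a} :=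
  ⟨0, fun _ ha => ha.1⟩

lemma le_cdf_optDec (hp : p < 1) : p ≤ cdf μ (optDec p μ) := by
  have hne : {a : ℝ | 0 ≤ a ∧ p ≤ cdf' μ a}.Nonempty := by
    obtain ⟨a, ha₀, ha⟩ := ((eventually_ge_atTop 0).and
      ((tendsto_cdf_atTop μ).eventually (eventually_gt_nhds hp))).exists
    exact ⟨a, ha₀, by rw [cdf'_eq_cdf]; exact ha.le⟩
  have ht : Tendsto (cdf μ) (𝓝[>] optDec p μ) (𝓝 (cdf μ (optDec p μ))) :=
    ((cdf μ).right_continuous _).mono_left (nhdsWithin_mono _ Ioi_subset_Ici_self)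
  refine ge_of_tendsto ht ?_
  filter_upwards [self_mem_nhdsWithin] with z hz
  obtain ⟨a, ha, haz⟩ := exists_lt_of_csInf_lt hne hz
  exact (cdf'_eq_cdf (μ := μ) a ▸ ha.2).trans (monotone_cdf μ haz.le)

lemma cdf_lt_of_lt_optDec (hsupp : μ (Iio 0) = 0) (hp : 0 < p) {z : ℝ} (hz : z < optDec p μ) :
    cdf μ z < p := by
  obtain hz₀ | hz₀ := lt_or_ge z 0
  · rw [cdf_eq_real, measureReal_def, measure_mono_null (Iic_subset_Iio.2 hz₀) hsupp]
    simpa using hp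
  · by_contra! h
    exact hz.not_ge (csInf_le (bddBelow_setOf_nonneg_and _) ⟨hz₀, by rwa [cdf'_eq_cdf]⟩)

lemma measureReal_Iio_optDec_le (hsupp : μ (Iio 0) = 0) (hp : 0 < p) :
    μ.real (Iio (optDec p μ)) ≤ p := by
  rw [measureReal_def, ← measure_cdf μ, StieltjesFunction.measure_Iio _ (tendsto_cdf_atBot μ),
    sub_zero, measure_cdf μ]
  refine ENNReal.toReal_le_of_le_ofReal hp.le (ENNReal.ofReal_le_ofReal ?_)
  refine le_of_tendsto ((monotone_cdf μ).tendsto_leftLim _) ?_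
  filter_upwards [self_mem_nhdsWithin] with z hz using (cdf_lt_of_lt_optDec hsupp hp hz).le

end Quantile

/-- **Hoeffding's inequality** for the empirical frequency of an event. -/
lemma iid_real_mul_le_sum_indicator_le (μ : Measure ℝ) [IsProbabilityMeasure μ] (n : ℕ)
    {s : Set ℝ} (hs : MeasurableSet s) {ε : ℝ} (hε : 0 ≤ ε) :
    (iid μ n).real {ω | n * (μ.real s + ε) ≤ ∑ i, s.indicator (1 : ℝ → ℝ) (ω i)} ≤
      Real.exp (-(2 * n * ε ^ 2)) := by
  have hm : Measurable (s.indicator (1 : ℝ → ℝ)) := measurable_one.indicator hs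
  have hX : HasSubgaussianMGF (fun z => s.indicator (1 : ℝ → ℝ) z - μ.real s)
      ((‖(1 : ℝ) - 0‖₊ / 2) ^ 2) μ := by
    have := hasSubgaussianMGF_of_mem_Icc (μ := μ) (a := 0) (b := 1) hm.aemeasurable
      (.of_forall fun z => ⟨indicator_nonneg (fun _ _ => zero_le_one) z,
        indicator_le_self' (fun _ _ => zero_le_one) z⟩)
    rwa [integral_indicator_one hs] at this
  have hind : iIndepFun (fun (i : Fin n) (ω : Fin n → ℝ) =>
      s.indicator (1 : ℝ → ℝ) (ω i) - μ.real s) (iid μ n) :=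
    iIndepFun_pi (μ := fun _ => μ)
      (X := fun (_ : Fin n) z => s.indicator (1 : ℝ → ℝ) z - μ.real s)
      fun _ => (hm.sub_const _).aemeasurable
  have hsub (i : Fin n) : HasSubgaussianMGF (fun ω : Fin n → ℝ =>
      s.indicator (1 : ℝ → ℝ) (ω i) - μ.real s) ((‖(1 : ℝ) - 0‖₊ / 2) ^ 2) (iid μ n) := by
    refine HasSubgaussianMGF.of_map (Y := fun ω : Fin n → ℝ => ω i)
      (X := fun z => s.indicator (1 : ℝ → ℝ) z - μ.real s) (measurable_pi_apply i).aemeasurable ?_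
    rw [iid, (measurePreserving_eval (fun _ : Fin n => μ) i).map_eq]
    exact hX
  have h := HasSubgaussianMGF.measure_sum_ge_le_of_iIndepFun hind (s := Finset.univ)
    (fun i _ => hsub i) (mul_nonneg n.cast_nonneg hε)
  refine (Eq.le ?_).trans (h.trans (Eq.le ?_))
  · congr 1
    ext ω
    simp only [mem_ofPred_eq, Finset.sum_sub_distrib, Finset.sum_const, Finset.card_univ,
      Fintype.card_fin, nsmul_eq_mul, le_sub_iff_add_le]
    rw [mul_add, add_comm]
  · congr 1
    obtain rfl | hn := n.eq_zero_or_pos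
    · simp
    · simp
      field_simp

lemma ite_le_eq_indicator (a z : ℝ) :
    (if z ≤ a then (1 : ℝ) else 0) = 1 - (Ioi a).indicator 1 z := by
  by_cases h : z ≤ a <;> simp [h, indicator, ← not_le]

/-- The SAA decision lies between the population quantiles at `q ∓ ε` when the empirical
frequencies of the two corresponding tails are within `ε` of their means. -/
lemma saa_mem_Icc_optDec {q ε : ℝ} {μ : Measure ℝ} [IsProbabilityMeasure μ] {n : ℕ}
    {ω : Fin n → ℝ} (hsupp : μ (Iio 0) = 0) (hn : 0 < n) (hlo : ε < q) (hhi : q + ε < 1)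
    (h₁ : ∑ i, (Iio (optDec (q - ε) μ)).indicator (1 : ℝ → ℝ) (ω i) <
      n * (μ.real (Iio (optDec (q - ε) μ)) + ε))
    (h₂ : ∑ i, (Ioi (optDec (q + ε) μ)).indicator (1 : ℝ → ℝ) (ω i) <
      n * (μ.real (Ioi (optDec (q + ε) μ)) + ε)) :
    saa q n ω ∈ Icc (optDec (q - ε) μ) (optDec (q + ε) μ) := by
  have hn' : (0 : ℝ) < n := Nat.cast_pos.2 hn
  have hmem : optDec (q + ε) μ ∈ {a : ℝ | 0 ≤ a ∧ q ≤ empCdf n ω a} := by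
    refine ⟨optDec_nonneg, ?_⟩
    have hF := le_cdf_optDec (μ := μ) hhi
    rw [cdf_eq_real] at hF
    have hc : μ.real (Ioi (optDec (q + ε) μ)) = 1 - μ.real (Iic (optDec (q + ε) μ)) := by
      rw [← compl_Iic, probReal_compl_eq_one_sub measurableSet_Iic]
    rw [empCdf, le_div_iff₀ hn']
    simp only [ite_le_eq_indicator, Finset.sum_sub_distrib, Finset.sum_const, Finset.card_univ,
      Fintype.card_fin, nsmul_eq_mul, mul_one]
    nlinarith
  refine ⟨le_csInf ⟨_, hmem⟩ fun a ha => ?_, csInf_le (bddBelow_setOf_nonneg_and _) hmem⟩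
  by_contra! hlt
  have hF := measureReal_Iio_optDec_le hsupp (sub_pos.2 hlo)
  have hq := ha.2
  rw [empCdf, le_div_iff₀ hn'] at hq
  have hle : ∑ i, (if ω i ≤ a then (1 : ℝ) else 0) ≤
      ∑ i, (Iio (optDec (q - ε) μ)).indicator (1 : ℝ → ℝ) (ω i) := by
    refine Finset.sum_le_sum fun i _ => ?_
    split_ifs with hi
    · rw [indicator_of_mem (mem_Iio.2 (hi.trans_lt hlt)), Pi.one_apply]
    · exact indicator_nonneg (fun _ _ => zero_le_one) _
  nlinarith

/-- High-probability multiplicative regret upper bound for SAA on any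
distribution with finite mean: if `n > log(2/δ)/(2(min{q,1−q})²)`, then with probability
at least `1−δ`, `(L(â) − L(a*))/L(a*) ≤ 2/(min{q,1−q}·√(2n/log(2/δ)) − 1)`. -/
theorem saa_high_prob_multiplicative_regret_general
    (q : ℝ) (hq : q ∈ Ioo (0:ℝ) 1)
    (μ : Measure ℝ) [IsProbabilityMeasure μ] (hsupp : μ (Iio 0) = 0)
    (hmean : Integrable (fun z => z) μ)
    (n : ℕ) (δ : ℝ) (hδ : δ ∈ Ioo (0:ℝ) 1)
    (hn : Real.log (2/δ) / (2 * (min q (1 - q))^2) < n) :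
    ENNReal.ofReal (1 - δ) ≤
      (iid μ n) {ω |
        (expLoss q μ (saa q n ω) - expLoss q μ (optDec q μ)) / expLoss q μ (optDec q μ)
          ≤ 2 / (min q (1 - q) * Real.sqrt (2*n / Real.log (2/δ)) - 1)} := by
  obtain ⟨hδ₀, hδ₁⟩ := hδ
  have hm : 0 < min q (1 - q) := lt_min hq.1 (sub_pos.2 hq.2)
  have hlog : 0 < Real.log (2 / δ) := Real.log_pos (by rw [lt_div_iff₀ hδ₀]; linarith)
  have hn₀ : (0 : ℝ) < n := lt_trans (by positivity) hn
  set r := Real.sqrt (2 * n / Real.log (2 / δ))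
  have hr₀ : 0 < r := Real.sqrt_pos.2 (by positivity)
  have hr₂ : r ^ 2 = 2 * n / Real.log (2 / δ) := Real.sq_sqrt (by positivity)
  have hε₀ : 0 < r⁻¹ := inv_pos.2 hr₀
  have hεq : r⁻¹ < min q (1 - q) := by
    rw [inv_lt_comm₀ hr₀ hm]
    refine Real.lt_sqrt_of_sq_lt ?_
    rw [inv_pow, inv_lt_iff_one_lt_mul₀ (by positivity)]
    rw [div_lt_iff₀ (by positivity)] at hn
    rw [div_mul_eq_mul_div, one_lt_div hlog]
    linarith
  have hexp : Real.exp (-(2 * n * r⁻¹ ^ 2)) = δ / 2 := by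
    rw [inv_pow, hr₂, inv_div, mul_div_cancel₀ _ (by positivity), Real.exp_neg,
      Real.exp_log (by positivity), inv_div]
  obtain ⟨hlo, hhi⟩ := lt_min_iff.1 hεq
  set T := {ω | (expLoss q μ (saa q n ω) - expLoss q μ (optDec q μ)) / expLoss q μ (optDec q μ)
    ≤ 2 / (min q (1 - q) * r - 1)}
  let B (s : Set ℝ) : Set (Fin n → ℝ) :=
    {ω | n * (μ.real s + r⁻¹) ≤ ∑ i, s.indicator (1 : ℝ → ℝ) (ω i)}
  have hT : Tᶜ ⊆ B (Iio (optDec (q - r⁻¹) μ)) ∪ B (Ioi (optDec (q + r⁻¹) μ)) := by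
    rw [compl_subset_comm]
    intro ω hω
    simp only [B, mem_compl_iff, mem_union, mem_ofPred_eq, not_or, not_le] at hω
    obtain ⟨h₁, h₂⟩ := saa_mem_Icc_optDec hsupp (Nat.cast_pos.1 hn₀) hlo (by linarith) hω.1 hω.2
    have hF := le_cdf_optDec (μ := μ) (p := q - r⁻¹) (by linarith [hq.2])
    rw [cdf_eq_real] at hF
    refine (div_expLoss_le_of_approx_quantile hq hmean hε₀ hεq
      (hF.trans (measureReal_mono (Iic_subset_Iic.2 h₁)))
      ((measureReal_mono (Iio_subset_Iio h₂)).trans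
        (measureReal_Iio_optDec_le hsupp (by linarith [hq.1]))) (optDec q μ)).trans (Eq.le ?_)
    rw [← mul_div_mul_right _ (min q (1 - q) - r⁻¹) hr₀.ne', sub_mul, mul_assoc 2,
      inv_mul_cancel₀ hr₀.ne', mul_one]
  have : IsProbabilityMeasure (iid μ n) := by
    unfold iid
    infer_instance
  have hTc : (iid μ n).real Tᶜ ≤ δ := by
    calc (iid μ n).real Tᶜ ≤ _ := measureReal_mono hT
      _ ≤ _ := measureReal_union_le _ _
      _ ≤ δ / 2 + δ / 2 := hexp ▸ add_le_add
          (iid_real_mul_le_sum_indicator_le μ n measurableSet_Iio hε₀.le)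
          (iid_real_mul_le_sum_indicator_le μ n measurableSet_Ioi hε₀.le)
      _ = δ := add_halves δ
  have hone : 1 ≤ (iid μ n).real T + (iid μ n).real Tᶜ := by
    rw [← probReal_univ (μ := iid μ n), ← union_compl_self T]
    exact measureReal_union_le _ _
  exact (ENNReal.ofReal_le_iff_le_toReal (measure_ne_top _ _)).2
    (show 1 - δ ≤ (iid μ n).real T by linarith)
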